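/- For every n ≥ 2 the group of McNaughton homeomorphisms of [0,1]^n acts topologically transitively: for all nonempty open subsets A, B of [0,1]^n there exists a McNaughton homeomorphism S of [0,1]^n with S(A) ∩ B ≠ ∅. -/

import Mathlib

/-- The unit cube `[0,1]^n` inside `Fin n → ℝ`. -/
def unitCube (n : ℕ) : Set (Fin n → ℝ) := Set.univ.pi fun _ => Set.Icc (0:ℝ) 1

/-- A McNaughton function in `n` variables: a continuous function
`[0,1]^n → [0,1]` which, at every point of the cube, agrees with one of
finitely many affine polynomials with integer coefficients. -/
def IsMcNaughtonFn {n : ℕ} (f : (Fin n → ℝ) → ℝ) : Prop :=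
  ContinuousOn f (unitCube n) ∧
  Set.MapsTo f (unitCube n) (Set.Icc (0:ℝ) 1) ∧
  ∃ (m : ℕ) (a : Fin m → Fin n → ℤ) (b : Fin m → ℤ),
    ∀ x ∈ unitCube n, ∃ j : Fin m,
      f x = (∑ i : Fin n, (a j i : ℝ) * x i) + (b j : ℝ)

/-- A McNaughton mapping of `[0,1]^n`: each coordinate is a McNaughton
function. -/
def IsMcNaughtonMap {n : ℕ} (S : (Fin n → ℝ) → (Fin n → ℝ)) : Prop :=
  ∀ i : Fin n, IsMcNaughtonFn (fun x => S x i)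

/-- A McNaughton homeomorphism of `[0,1]^n`: a McNaughton mapping which is a
bijection of the cube onto itself whose inverse is also a McNaughton mapping. -/
def IsMcNaughtonHomeo {n : ℕ} (S : (Fin n → ℝ) → (Fin n → ℝ)) : Prop :=
  IsMcNaughtonMap S ∧ ∃ T : (Fin n → ℝ) → (Fin n → ℝ), IsMcNaughtonMap T ∧
    (∀ x ∈ unitCube n, T (S x) = x) ∧ (∀ x ∈ unitCube n, S (T x) = x)

/-- `p ∈ [0,1]^n` has `d` as a denominator: `d > 0` and `d • p ∈ ℤ^n`. -/
def IsDenom {n : ℕ} (p : Fin n → ℝ) (d : ℕ) : Prop :=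
  0 < d ∧ ∀ i : Fin n, ∃ z : ℤ, (d : ℝ) * p i = (z : ℝ)

/-- The denominator of a point: the least positive integer `d` with
`d • p ∈ ℤ^n` (junk value `0` if there is none). -/
noncomputable def den {n : ℕ} (p : Fin n → ℝ) : ℕ := sInf {d | IsDenom p d}

/-- Rotation by `s` along the boundary of a triangle of side `α + β + δ`. A boundary point is encoded
by its distances `α`, `β`, `δ` to the three sides, one of them zero; this is the new value of `α`. -/
noncomputable def turn (α β δ s : ℝ) : ℝ :=
  max 0 (max (α - s) (max (s - α - δ) (min (α + s - δ) (α + 2 * β - s))))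

theorem turn_ahead {α β s : ℝ} (hα : 0 ≤ α) (hs : 0 ≤ s) (h : s ≤ β) :
    turn α β 0 s = α + s ∧ turn β 0 α s = β - s ∧ turn 0 α β s = 0 := by
  refine ⟨?_, ?_, ?_⟩ <;> simp only [turn] <;> grind

theorem turn_corner {α β s : ℝ} (hα : 0 ≤ α) (hβ : 0 ≤ β) (h : β ≤ s) (h' : s ≤ α + β) :
    turn α β 0 s = α + 2 * β - s ∧ turn β 0 α s = 0 ∧ turn 0 α β s = s - β := by
  refine ⟨?_, ?_, ?_⟩ <;> simp only [turn] <;> grind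

theorem turn_nonneg (α β δ s : ℝ) : 0 ≤ turn α β δ s := le_max_left _ _

theorem turn_sum_and_inverse_of_zero {α β s : ℝ} (hα : 0 ≤ α) (hβ : 0 ≤ β) (hs : 0 ≤ s)
    (h : s ≤ α + β) :
    (turn α β 0 s + turn β 0 α s + turn 0 α β s = α + β ∧
      (turn α β 0 s = 0 ∨ turn β 0 α s = 0 ∨ turn 0 α β s = 0)) ∧
    turn (turn α β 0 s) (turn 0 α β s) (turn β 0 α s) s = α ∧
    turn (turn β 0 α s) (turn α β 0 s) (turn 0 α β s) s = β ∧
    turn (turn 0 α β s) (turn β 0 α s) (turn α β 0 s) s = 0 := by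
  rcases le_total s β with hb | hb
  · obtain ⟨h1, h2, h3⟩ := turn_ahead hα hs hb
    obtain ⟨k1, k2, k3⟩ := turn_ahead (α := β - s) (β := α + s) (s := s) (by linarith) hs
      (by linarith)
    rw [h1, h2, h3, k1, k2, k3]
    exact ⟨⟨by ring, by simp⟩, by ring, by ring, rfl⟩
  · obtain ⟨h1, h2, h3⟩ := turn_corner hα hβ hb h
    obtain ⟨k1, k2, k3⟩ := turn_corner (α := α + 2 * β - s) (β := s - β) (s := s) (by linarith)
      (by linarith) (by linarith) (by linarith)
    rw [h1, h2, h3, k1, k2, k3]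
    exact ⟨⟨by ring, by simp⟩, by ring, by ring, rfl⟩

theorem turn_sum_and_inverse {α β δ s : ℝ} (hα : 0 ≤ α) (hβ : 0 ≤ β) (hδ : 0 ≤ δ)
    (h0 : α = 0 ∨ β = 0 ∨ δ = 0) (hs : 0 ≤ s) (h : s ≤ α + β + δ) :
    (turn α β δ s + turn β δ α s + turn δ α β s = α + β + δ ∧
      (turn α β δ s = 0 ∨ turn β δ α s = 0 ∨ turn δ α β s = 0)) ∧
    turn (turn α β δ s) (turn δ α β s) (turn β δ α s) s = α ∧
    turn (turn β δ α s) (turn α β δ s) (turn δ α β s) s = β := by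
  rcases h0 with rfl | rfl | rfl
  · have := turn_sum_and_inverse_of_zero hβ hδ hs (by linarith)
    grind
  · have := turn_sum_and_inverse_of_zero hδ hα hs (by linarith)
    grind
  · have := turn_sum_and_inverse_of_zero hα hβ hs (by linarith)
    grind

/-- The triangle with vertices `(0,0)`, `(1,0)`, `(0,1)` is filled by concentric triangles, on each of
which this function is constant. -/
noncomputable def triangleLevel (a b : ℝ) : ℝ := min a (min b (1 - a - b))

/-- The amount by which a twist rotates the level triangle at level `m`. The two outer bounds keep it
at most the length of a side and make it vanish on and outside the big triangle. -/
noncomputable def twistAmount (k l : ℤ) (M : ℕ) (m : ℝ) : ℝ :=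
  max 0 (min (k * m + l) (min (1 - 3 * m) (M * m)))

/-- First coordinate of the twist rotating every level triangle. -/
noncomputable def twistFst (k l : ℤ) (M : ℕ) (a b : ℝ) : ℝ :=
  triangleLevel a b + turn (a - triangleLevel a b) (b - triangleLevel a b)
    (1 - a - b - triangleLevel a b) (twistAmount k l M (triangleLevel a b))

/-- Second coordinate of the twist rotating every level triangle. -/
noncomputable def twistSnd (k l : ℤ) (M : ℕ) (a b : ℝ) : ℝ :=
  triangleLevel a b + turn (b - triangleLevel a b) (1 - a - b - triangleLevel a b)
    (a - triangleLevel a b) (twistAmount k l M (triangleLevel a b))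

theorem triangleLevel_comm (a b : ℝ) : triangleLevel a b = triangleLevel b a := by
  unfold triangleLevel; grind

theorem triangleLevel_spec (a b : ℝ) :
    triangleLevel a b ≤ a ∧ triangleLevel a b ≤ b ∧ triangleLevel a b ≤ 1 - a - b ∧
    (a - triangleLevel a b = 0 ∨ b - triangleLevel a b = 0 ∨
      1 - a - b - triangleLevel a b = 0) := by
  unfold triangleLevel; grind

theorem twistAmount_nonneg (k l : ℤ) (M : ℕ) (m : ℝ) : 0 ≤ twistAmount k l M m := le_max_left _ _

theorem twistAmount_le (k l : ℤ) (M : ℕ) {m : ℝ} (hm : 3 * m ≤ 1) :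
    twistAmount k l M m ≤ 1 - 3 * m := by
  unfold twistAmount; grind

theorem twistAmount_eq_zero (k l : ℤ) (M : ℕ) {m : ℝ} (hm : m ≤ 0) :
    twistAmount k l M m = 0 := by
  have : (M : ℝ) * m ≤ 0 := mul_nonpos_of_nonneg_of_nonpos M.cast_nonneg hm
  unfold twistAmount; grind

theorem twist_spec (k l : ℤ) (M : ℕ) (a b : ℝ) :
    triangleLevel (twistFst k l M a b) (twistSnd k l M a b) = triangleLevel a b ∧
    twistSnd k l M (twistSnd k l M a b) (twistFst k l M a b) = a ∧
    twistFst k l M (twistSnd k l M a b) (twistFst k l M a b) = b := by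
  obtain ⟨ha, hb, hd, h0⟩ := triangleLevel_spec a b
  have hs := twistAmount_nonneg k l M (triangleLevel a b)
  have hs' := twistAmount_le k l M (m := triangleLevel a b) (by linarith)
  obtain ⟨⟨hsum, hz⟩, h1, h2⟩ := turn_sum_and_inverse (sub_nonneg.2 ha) (sub_nonneg.2 hb)
    (sub_nonneg.2 hd) h0 hs (by linarith)
  have e : 1 - twistFst k l M a b - twistSnd k l M a b = triangleLevel a b +
      turn (1 - a - b - triangleLevel a b) (a - triangleLevel a b) (b - triangleLevel a b)
        (twistAmount k l M (triangleLevel a b)) := by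
    unfold twistFst twistSnd
    linarith
  have hlevel : triangleLevel (twistFst k l M a b) (twistSnd k l M a b) = triangleLevel a b := by
    rw [triangleLevel, e, twistFst, twistSnd, min_add_add_left, min_add_add_left, add_eq_left]
    have n1 := turn_nonneg (a - triangleLevel a b) (b - triangleLevel a b)
      (1 - a - b - triangleLevel a b) (twistAmount k l M (triangleLevel a b))
    have n2 := turn_nonneg (b - triangleLevel a b) (1 - a - b - triangleLevel a b)
      (a - triangleLevel a b) (twistAmount k l M (triangleLevel a b))
    have n3 := turn_nonneg (1 - a - b - triangleLevel a b) (a - triangleLevel a b)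
      (b - triangleLevel a b) (twistAmount k l M (triangleLevel a b))
    rcases hz with h | h | h <;> rw [h] <;> simp [*]
  have e' : 1 - twistSnd k l M a b - twistFst k l M a b - triangleLevel a b =
      turn (1 - a - b - triangleLevel a b) (a - triangleLevel a b) (b - triangleLevel a b)
        (twistAmount k l M (triangleLevel a b)) := by
    linarith
  have e1 : twistFst k l M a b - triangleLevel a b = turn (a - triangleLevel a b)
      (b - triangleLevel a b) (1 - a - b - triangleLevel a b)
        (twistAmount k l M (triangleLevel a b)) := by
    rw [twistFst]; ring
  have e2 : twistSnd k l M a b - triangleLevel a b = turn (b - triangleLevel a b)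
      (1 - a - b - triangleLevel a b) (a - triangleLevel a b)
        (twistAmount k l M (triangleLevel a b)) := by
    rw [twistSnd]; ring
  refine ⟨hlevel, ?_, ?_⟩
  · rw [twistSnd, triangleLevel_comm, hlevel, e', e1, e2, h1]; ring
  · rw [twistFst, triangleLevel_comm, hlevel, e', e1, e2, h2]; ring

theorem twist_mem_Icc (k l : ℤ) (M : ℕ) {a b : ℝ} (ha : a ∈ Set.Icc (0 : ℝ) 1)
    (hb : b ∈ Set.Icc (0 : ℝ) 1) :
    twistFst k l M a b ∈ Set.Icc (0 : ℝ) 1 ∧ twistSnd k l M a b ∈ Set.Icc (0 : ℝ) 1 := by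
  obtain ⟨h1, h2, h3, h0⟩ := triangleLevel_spec a b
  rcases le_total (triangleLevel a b) 0 with hm | hm
  · have hz := twistAmount_eq_zero k l M hm
    have hfix : twistFst k l M a b = a ∧ twistSnd k l M a b = b := by
      rw [twistFst, twistSnd, hz]
      generalize triangleLevel a b = m at *
      unfold turn
      constructor <;> grind
    rw [hfix.1, hfix.2]
    exact ⟨ha, hb⟩
  · have hlevel := (twist_spec k l M a b).1
    obtain ⟨g1, g2, g3, -⟩ := triangleLevel_spec (twistFst k l M a b) (twistSnd k l M a b)
    rw [hlevel] at g1 g2 g3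
    refine ⟨⟨?_, ?_⟩, ?_, ?_⟩ <;> linarith

/-- Along the edge of its level triangle on which `a` is least, a twist translates `b`. -/
theorem twist_on_side (k l : ℤ) (M : ℕ) {a b : ℝ} (h1 : a ≤ b)
    (h2 : twistAmount k l M a ≤ 1 - 2 * a - b) :
    twistFst k l M a b = a ∧ twistSnd k l M a b = b + twistAmount k l M a := by
  have hs := twistAmount_nonneg k l M a
  have hm : triangleLevel a b = a := by unfold triangleLevel; grind
  rw [twistFst, twistSnd, hm]
  obtain ⟨e1, -, e3⟩ := turn_ahead (α := b - a) (β := 1 - a - b - a) (sub_nonneg.2 h1) hs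
    (by linarith)
  rw [sub_self, e1, e3]
  constructor <;> ring

theorem twist_on_side_reverse (k l : ℤ) (M : ℕ) {a b : ℝ} (h1 : 2 * a + b ≤ 1)
    (h2 : twistAmount k l M a ≤ b - a) :
    twistFst k l M b a = b - twistAmount k l M a ∧ twistSnd k l M b a = a := by
  have hs := twistAmount_nonneg k l M a
  have hm : triangleLevel b a = a := by unfold triangleLevel; grind
  rw [twistFst, twistSnd, hm]
  obtain ⟨-, e2, e3⟩ := turn_ahead (α := 1 - b - a - a) (β := b - a) (by linarith) hs h2
  rw [sub_self, e2, e3]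
  constructor <;> ring

theorem twist_on_hypotenuse (k l : ℤ) (M : ℕ) {a b : ℝ} (h1 : 1 - a - b ≤ a)
    (h2 : twistAmount k l M (1 - a - b) ≤ b - (1 - a - b)) :
    twistFst k l M a b = a + twistAmount k l M (1 - a - b) ∧
    twistSnd k l M a b = b - twistAmount k l M (1 - a - b) := by
  have hs := twistAmount_nonneg k l M (1 - a - b)
  have hm : triangleLevel a b = 1 - a - b := by unfold triangleLevel; grind
  rw [twistFst, twistSnd, hm]
  obtain ⟨e1, e2, -⟩ := turn_ahead (α := a - (1 - a - b)) (β := b - (1 - a - b)) (by linarith) hs h2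
  rw [sub_self, e1, e2]
  constructor <;> ring

theorem exists_twistAmount_mem {m : ℝ} (hirr : Irrational m) (hm : 0 < m) {O : Set ℝ}
    (hO : IsOpen O) {t : ℝ} (ht : t ∈ O) (ht0 : 0 < t) (ht1 : t < 1 - 3 * m) :
    ∃ k l : ℤ, ∃ M : ℕ, twistAmount k l M m ∈ O := by
  have hd : Dense (AddSubgroup.closure {m, (1 : ℝ)} : Set ℝ) := by
    rw [dense_addSubgroupClosure_pair_iff]
    simpa using hirr
  obtain ⟨s, hs, hsm⟩ := hd.exists_mem_open (hO.inter (isOpen_Ioo (a := (0 : ℝ)) (b := 1 - 3 * m)))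
    ⟨t, ht, ht0, ht1⟩
  obtain ⟨k, l, rfl⟩ := AddSubgroup.mem_closure_pair.1 hs
  obtain ⟨M, hM⟩ := exists_nat_ge ((k • m + l • (1 : ℝ)) / m)
  refine ⟨k, l, M, ?_⟩
  rw [div_le_iff₀ hm] at hM
  obtain ⟨h1, h2, h3⟩ := hsm
  simp only [zsmul_eq_mul, mul_one] at h1 h2 h3 hM
  rwa [twistAmount, min_eq_left (le_min h3.le hM), max_eq_right h2.le]

/-- Continuous functions on `ℝⁿ` with finitely many pieces, each affine with integer
coefficients. -/
def IsIntegralPL {n : ℕ} (f : (Fin n → ℝ) → ℝ) : Prop :=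
  Continuous f ∧ ∃ F : Set ((Fin n → ℤ) × ℤ), F.Finite ∧
    ∀ x, ∃ c ∈ F, f x = (∑ i, (c.1 i : ℝ) * x i) + (c.2 : ℝ)

namespace IsIntegralPL

variable {n : ℕ} {f g : (Fin n → ℝ) → ℝ}

theorem const (z : ℤ) : IsIntegralPL (fun _ : Fin n → ℝ => (z : ℝ)) :=
  ⟨continuous_const, {(0, z)}, Set.finite_singleton _, fun x => ⟨_, rfl, by simp⟩⟩

theorem proj (i : Fin n) : IsIntegralPL (fun x : Fin n → ℝ => x i) :=
  ⟨continuous_apply i, {(Pi.single i 1, 0)}, Set.finite_singleton _, fun x => ⟨_, rfl, by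
    simp [Pi.single_apply]⟩⟩

theorem add (hf : IsIntegralPL f) (hg : IsIntegralPL g) : IsIntegralPL (fun x => f x + g x) := by
  obtain ⟨cf, F, hF, hfF⟩ := hf
  obtain ⟨cg, G, hG, hgG⟩ := hg
  refine ⟨cf.add cg, Set.image2 (· + ·) F G, hF.image2 _ hG, fun x => ?_⟩
  obtain ⟨c, hc, hcx⟩ := hfF x
  obtain ⟨d, hd, hdx⟩ := hgG x
  refine ⟨c + d, Set.mem_image2_of_mem hc hd, ?_⟩
  simp only [hcx, hdx, Prod.fst_add, Prod.snd_add, Pi.add_apply, Int.cast_add, add_mul,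
    Finset.sum_add_distrib]
  ring

theorem const_mul (z : ℤ) (hf : IsIntegralPL f) : IsIntegralPL (fun x => (z : ℝ) * f x) := by
  obtain ⟨cf, F, hF, hfF⟩ := hf
  refine ⟨continuous_const.mul cf, (fun c => z • c) '' F, hF.image _, fun x => ?_⟩
  obtain ⟨c, hc, hcx⟩ := hfF x
  refine ⟨z • c, Set.mem_image_of_mem _ hc, ?_⟩
  simp only [hcx, Prod.smul_fst, Prod.smul_snd, Pi.smul_apply, smul_eq_mul, Int.cast_mul,
    mul_add, Finset.mul_sum, mul_assoc]

theorem sub (hf : IsIntegralPL f) (hg : IsIntegralPL g) : IsIntegralPL (fun x => f x - g x) := by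
  simpa [sub_eq_add_neg] using hf.add (hg.const_mul (-1))

theorem max (hf : IsIntegralPL f) (hg : IsIntegralPL g) :
    IsIntegralPL (fun x => max (f x) (g x)) := by
  obtain ⟨cf, F, hF, hfF⟩ := hf
  obtain ⟨cg, G, hG, hgG⟩ := hg
  refine ⟨cf.max cg, F ∪ G, hF.union hG, fun x => ?_⟩
  rcases max_choice (f x) (g x) with h | h <;> simp only [h]
  · exact (hfF x).imp fun c hc => ⟨Or.inl hc.1, hc.2⟩
  · exact (hgG x).imp fun c hc => ⟨Or.inr hc.1, hc.2⟩

theorem min (hf : IsIntegralPL f) (hg : IsIntegralPL g) :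
    IsIntegralPL (fun x => min (f x) (g x)) := by
  obtain ⟨cf, F, hF, hfF⟩ := hf
  obtain ⟨cg, G, hG, hgG⟩ := hg
  refine ⟨cf.min cg, F ∪ G, hF.union hG, fun x => ?_⟩
  rcases min_choice (f x) (g x) with h | h <;> simp only [h]
  · exact (hfF x).imp fun c hc => ⟨Or.inl hc.1, hc.2⟩
  · exact (hgG x).imp fun c hc => ⟨Or.inr hc.1, hc.2⟩

theorem isMcNaughtonFn (hf : IsIntegralPL f)
    (h : Set.MapsTo f (unitCube n) (Set.Icc (0 : ℝ) 1)) : IsMcNaughtonFn f := by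
  obtain ⟨cf, F, hF, hfF⟩ := hf
  have := hF.fintype
  refine ⟨cf.continuousOn, h, Fintype.card F, fun j => ((Fintype.equivFin F).symm j).1.1,
    fun j => ((Fintype.equivFin F).symm j).1.2, fun x _ => ?_⟩
  obtain ⟨c, hc, hcx⟩ := hfF x
  exact ⟨Fintype.equivFin F ⟨c, hc⟩, by simpa using hcx⟩

theorem turn {a b d s : (Fin n → ℝ) → ℝ} (ha : IsIntegralPL a) (hb : IsIntegralPL b)
    (hd : IsIntegralPL d) (hs : IsIntegralPL s) :
    IsIntegralPL (fun x => turn (a x) (b x) (d x) (s x)) := by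
  have h0 := const (n := n) 0
  have h2 := hb.const_mul 2
  push_cast at h0 h2
  exact h0.max ((ha.sub hs).max (((hs.sub ha).sub hd).max (((ha.add hs).sub hd).min
    ((ha.add h2).sub hs))))

theorem triangleLevel (hf : IsIntegralPL f) (hg : IsIntegralPL g) :
    IsIntegralPL (fun x => triangleLevel (f x) (g x)) := by
  have h1 := const (n := n) 1
  push_cast at h1
  exact hf.min (hg.min ((h1.sub hf).sub hg))

theorem twistAmount (k l : ℤ) (M : ℕ) (hf : IsIntegralPL f) :
    IsIntegralPL (fun x => twistAmount k l M (f x)) := by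
  have h0 := const (n := n) 0
  have h1 := const (n := n) 1
  have h3 := hf.const_mul 3
  have hM := hf.const_mul M
  push_cast at h0 h1 h3 hM
  exact h0.max (((hf.const_mul k).add (const l)).min ((h1.sub h3).min hM))

theorem twistFst (k l : ℤ) (M : ℕ) (hf : IsIntegralPL f) (hg : IsIntegralPL g) :
    IsIntegralPL (fun x => twistFst k l M (f x) (g x)) := by
  have h1 := const (n := n) 1
  push_cast at h1
  have hm := hf.triangleLevel hg
  exact hm.add ((hf.sub hm).turn (hg.sub hm) (((h1.sub hf).sub hg).sub hm) (hm.twistAmount k l M))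

theorem twistSnd (k l : ℤ) (M : ℕ) (hf : IsIntegralPL f) (hg : IsIntegralPL g) :
    IsIntegralPL (fun x => twistSnd k l M (f x) (g x)) := by
  have h1 := const (n := n) 1
  push_cast at h1
  have hm := hf.triangleLevel hg
  exact hm.add ((hg.sub hm).turn (((h1.sub hf).sub hg).sub hm) (hf.sub hm) (hm.twistAmount k l M))

end IsIntegralPL

theorem isMcNaughtonMap_of_isIntegralPL {n : ℕ} {S : (Fin n → ℝ) → (Fin n → ℝ)}
    (hS : ∀ i, IsIntegralPL (fun x => S x i)) (h : Set.MapsTo S (unitCube n) (unitCube n)) :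
    IsMcNaughtonMap S :=
  fun i => (hS i).isMcNaughtonFn fun _ hx => h hx i trivial

theorem IsMcNaughtonMap.mapsTo {n : ℕ} {S : (Fin n → ℝ) → (Fin n → ℝ)} (hS : IsMcNaughtonMap S) :
    Set.MapsTo S (unitCube n) (unitCube n) :=
  fun _ hx i _ => (hS i).2.1 hx

theorem IsMcNaughtonMap.continuousOn {n : ℕ} {S : (Fin n → ℝ) → (Fin n → ℝ)}
    (hS : IsMcNaughtonMap S) : ContinuousOn S (unitCube n) :=
  continuousOn_pi.2 fun i => (hS i).1

theorem IsMcNaughtonFn.comp {n : ℕ} {f : (Fin n → ℝ) → ℝ} {S : (Fin n → ℝ) → (Fin n → ℝ)}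
    (hf : IsMcNaughtonFn f) (hS : IsMcNaughtonMap S) : IsMcNaughtonFn (fun x => f (S x)) := by
  obtain ⟨cf, mf, m, a, b, h⟩ := hf
  choose p c d hp using fun i => (hS i).2.2
  refine ⟨cf.comp hS.continuousOn hS.mapsTo, fun x hx => mf (hS.mapsTo hx), ?_⟩
  let e := Fintype.equivFin (Fin m × ∀ i, Fin (p i))
  refine ⟨_, fun j i => ∑ r, a (e.symm j).1 r * c r ((e.symm j).2 r) i,
    fun j => (∑ r, a (e.symm j).1 r * d r ((e.symm j).2 r)) + b (e.symm j).1, fun x hx => ?_⟩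
  obtain ⟨j, hj⟩ := h _ (hS.mapsTo hx)
  choose q hq using fun i => hp i x hx
  refine ⟨e (j, q), ?_⟩
  simp only [hj, hq, Equiv.symm_apply_apply]
  push_cast
  simp only [mul_add, Finset.sum_add_distrib, Finset.mul_sum, Finset.sum_mul, add_assoc, mul_assoc]
  rw [Finset.sum_comm]

theorem IsMcNaughtonMap.comp {n : ℕ} {S T : (Fin n → ℝ) → (Fin n → ℝ)}
    (hS : IsMcNaughtonMap S) (hT : IsMcNaughtonMap T) : IsMcNaughtonMap (fun x => S (T x)) :=
  fun i => (hS i).comp hT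

theorem IsMcNaughtonHomeo.comp {n : ℕ} {S T : (Fin n → ℝ) → (Fin n → ℝ)}
    (hS : IsMcNaughtonHomeo S) (hT : IsMcNaughtonHomeo T) :
    IsMcNaughtonHomeo (fun x => S (T x)) := by
  obtain ⟨hS, S', hS', h1, h2⟩ := hS
  obtain ⟨hT, T', hT', h3, h4⟩ := hT
  refine ⟨hS.comp hT, fun x => T' (S' x), hT'.comp hS', fun x hx => ?_, fun x hx => ?_⟩
  · simp only [h1 _ (hT.mapsTo hx), h3 x hx]
  · simp only [h4 _ (hS'.mapsTo hx), h2 x hx]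

theorem isMcNaughtonHomeo_id {n : ℕ} : IsMcNaughtonHomeo (fun x : Fin n → ℝ => x) := by
  have h : IsMcNaughtonMap (fun x : Fin n → ℝ => x) :=
    isMcNaughtonMap_of_isIntegralPL IsIntegralPL.proj fun _ h => h
  exact ⟨h, _, h, fun _ _ => rfl, fun _ _ => rfl⟩

open Function in
theorem update_mem_unitCube {n : ℕ} {x : Fin n → ℝ} (hx : x ∈ unitCube n) (i : Fin n) {t : ℝ}
    (ht : t ∈ Set.Icc (0 : ℝ) 1) : update x i t ∈ unitCube n := by
  intro j _
  by_cases h : j = i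
  · subst h; simpa using ht
  · simpa [h] using hx j trivial

/-- The reflection of the cube in the `i`-th coordinate. -/
def flipCoord {n : ℕ} (i : Fin n) (x : Fin n → ℝ) : Fin n → ℝ := Function.update x i (1 - x i)

theorem isMcNaughtonHomeo_flipCoord {n : ℕ} (i : Fin n) : IsMcNaughtonHomeo (flipCoord i) := by
  have h : IsMcNaughtonMap (flipCoord i) := by
    refine isMcNaughtonMap_of_isIntegralPL (fun j => ?_) fun x hx => ?_
    · by_cases hj : j = i
      · subst hj
        simpa [flipCoord] using (IsIntegralPL.const (n := n) 1).sub (IsIntegralPL.proj j)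
      · simpa [flipCoord, hj] using IsIntegralPL.proj j
    · have := hx i trivial
      exact update_mem_unitCube hx i ⟨by linarith [this.2], by linarith [this.1]⟩
  have hinv (x : Fin n → ℝ) : flipCoord i (flipCoord i x) = x := by simp [flipCoord]
  exact ⟨h, _, h, fun x _ => hinv x, fun x _ => hinv x⟩

theorem isMcNaughtonHomeo_swap {n : ℕ} (i j : Fin n) :
    IsMcNaughtonHomeo (fun x : Fin n → ℝ => x ∘ Equiv.swap i j) := by
  have h : IsMcNaughtonMap (fun x : Fin n → ℝ => x ∘ Equiv.swap i j) :=
    isMcNaughtonMap_of_isIntegralPL (fun _ => IsIntegralPL.proj _) fun x hx _ _ => hx _ trivial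
  exact ⟨h, _, h, fun x _ => by ext; simp, fun x _ => by ext; simp⟩

/-- The twist of the cube acting on the coordinates `i` and `j`. -/
noncomputable def twist {n : ℕ} (i j : Fin n) (k l : ℤ) (M : ℕ) (x : Fin n → ℝ) : Fin n → ℝ :=
  Function.update (Function.update x i (twistFst k l M (x i) (x j))) j
    (twistSnd k l M (x i) (x j))

theorem isMcNaughtonHomeo_twist {n : ℕ} {i j : Fin n} (hij : i ≠ j) (k l : ℤ) (M : ℕ) :
    IsMcNaughtonHomeo (twist i j k l M) := by
  have hmap (i j : Fin n) : IsMcNaughtonMap (twist i j k l M) := by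
    refine isMcNaughtonMap_of_isIntegralPL (fun r => ?_) fun x hx => ?_
    · by_cases hj : r = j
      · subst hj
        simpa [twist] using (IsIntegralPL.proj i).twistSnd k l M (IsIntegralPL.proj r)
      by_cases hi : r = i
      · subst hi
        simpa [twist, hj] using (IsIntegralPL.proj r).twistFst k l M (IsIntegralPL.proj j)
      · simpa [twist, hi, hj] using IsIntegralPL.proj r
    · have := twist_mem_Icc k l M (hx i trivial) (hx j trivial)
      exact update_mem_unitCube (update_mem_unitCube hx i this.1) j this.2
  have hinv {i j : Fin n} (hij : i ≠ j) (x : Fin n → ℝ) :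
      twist j i k l M (twist i j k l M x) = x := by
    obtain ⟨-, h1, h2⟩ := twist_spec k l M (x i) (x j)
    ext r
    by_cases hi : r = i
    · subst hi; simp [twist, hij, h1]
    by_cases hj : r = j
    · subst hj; simp [twist, hij, hij.symm, h2]
    · simp [twist, hi, hj]
  exact ⟨hmap i j, _, hmap j i, fun x _ => hinv hij x, fun x _ => hinv hij.symm x⟩

/-- The points of the cube that some McNaughton homeomorphism carries into `A`. -/
def orbitSet {n : ℕ} (A : Set (Fin n → ℝ)) : Set (Fin n → ℝ) :=
  {x | x ∈ unitCube n ∧ ∃ S, IsMcNaughtonHomeo S ∧ S x ∈ A}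

theorem IsMcNaughtonHomeo.apply_mem_orbitSet {n : ℕ} {A : Set (Fin n → ℝ)}
    {T : (Fin n → ℝ) → (Fin n → ℝ)} (hT : IsMcNaughtonHomeo T) {x : Fin n → ℝ}
    (hx : x ∈ orbitSet A) : T x ∈ orbitSet A := by
  obtain ⟨hxc, S, hS, hSx⟩ := hx
  obtain ⟨hT, T', hT', h1, h2⟩ := hT
  refine ⟨hT.mapsTo hxc, _, hS.comp ⟨hT', T, hT, h2, h1⟩, ?_⟩
  simpa only [h1 x hxc] using hSx

theorem exists_isOpen_inter_subset_orbitSet {n : ℕ} {A : Set (Fin n → ℝ)} (hA : IsOpen A)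
    {x : Fin n → ℝ} (hx : x ∈ orbitSet A) :
    ∃ N, IsOpen N ∧ x ∈ N ∧ N ∩ unitCube n ⊆ orbitSet A := by
  obtain ⟨hxc, S, hS, hSx⟩ := hx
  obtain ⟨N, hN, h⟩ := continuousOn_iff'.1 hS.1.continuousOn A hA
  refine ⟨N, hN, (h.subset ⟨hSx, hxc⟩).1, fun y hy => ⟨hy.2, S, hS, (h.superset hy).1⟩⟩

open Function in
theorem exists_mem_orbitSet_irrational {n : ℕ} {A : Set (Fin n → ℝ)} (hA : IsOpen A)
    {p : Fin n → ℝ} (hp : p ∈ closure (orbitSet A)) {i j : Fin n} (hij : i ≠ j)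
    (hpi : p i ∈ Set.Ioo (0 : ℝ) 1) (e : ℝ) {N : Set (Fin n → ℝ)} (hN : IsOpen N) (hpN : p ∈ N) :
    ∃ x ∈ orbitSet A, x ∈ N ∧ Irrational (x i + e * x j) := by
  have ho : IsOpen (N ∩ {x | x i ∈ Set.Ioo (0 : ℝ) 1}) :=
    hN.inter (isOpen_Ioo.preimage (continuous_apply i))
  obtain ⟨x, ⟨hxN, hxi⟩, hx⟩ := mem_closure_iff.1 hp _ ho ⟨hpN, hpi⟩
  obtain ⟨N', hN', hxN', hsub⟩ := exists_isOpen_inter_subset_orbitSet hA hx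
  have hc : Continuous fun u : ℝ => update x i (u - e * x j) := by fun_prop
  obtain ⟨u, hu, hirr⟩ := dense_irrational.exists_mem_open
    (((hN.inter hN').preimage hc).inter
      ((isOpen_Ioo (a := (0 : ℝ)) (b := 1)).preimage (continuous_id.sub continuous_const)))
    ⟨x i + e * x j, by
      change update x i (x i + e * x j - e * x j) ∈ N ∩ N' ∧
        x i + e * x j - e * x j ∈ Set.Ioo (0 : ℝ) 1
      rw [add_sub_cancel_right, update_eq_self]
      exact ⟨⟨hxN, hxN'⟩, hxi⟩⟩
  obtain ⟨hirr, ⟨h1, h2⟩, h3⟩ := And.intro hu hirr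
  refine ⟨_, hsub ⟨h2, update_mem_unitCube hx.1 i ⟨h3.1.le, h3.2.le⟩⟩, h1, ?_⟩
  simpa [hij.symm] using hirr

/-- A motion that twists realise for the amounts `twistAmount k l M (ℓ x)` preserves the closure of
an orbit, since these amounts are dense when the level `ℓ x` is irrational. -/
theorem motion_mem_closure_orbitSet {n : ℕ} {A : Set (Fin n → ℝ)} (hA : IsOpen A)
    {p : Fin n → ℝ} (hp : p ∈ closure (orbitSet A)) {i j : Fin n} (hij : i ≠ j)
    (hpi : p i ∈ Set.Ioo (0 : ℝ) 1) (e : ℝ) {ℓ : (Fin n → ℝ) → ℝ}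
    (hℓ : ∀ x, Irrational (x i + e * x j) → Irrational (ℓ x))
    {φ : (Fin n → ℝ) × ℝ → (Fin n → ℝ)} (hφ : Continuous φ)
    {Q : Set ((Fin n → ℝ) × ℝ)} (hQ : IsOpen Q) {δ : ℝ} (hpQ : (p, δ) ∈ Q)
    (hbound : ∀ x s, (x, s) ∈ Q → 0 < ℓ x ∧ 0 < s ∧ s < 1 - 3 * ℓ x)
    (hT : ∀ x k l M, (x, twistAmount k l M (ℓ x)) ∈ Q →
      ∃ T, IsMcNaughtonHomeo T ∧ T x = φ (x, twistAmount k l M (ℓ x))) :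
    φ (p, δ) ∈ closure (orbitSet A) := by
  refine mem_closure_iff.2 fun N hN hpN => ?_
  have ho : IsOpen (Q ∩ φ ⁻¹' N) := hQ.inter (hN.preimage hφ)
  obtain ⟨x, hx, hxQ, hirr⟩ := exists_mem_orbitSet_irrational hA hp hij hpi e
    (ho.preimage (Continuous.prodMk_left δ)) ⟨hpQ, hpN⟩
  obtain ⟨h1, h2, h3⟩ := hbound x δ hxQ.1
  obtain ⟨k, l, M, hs⟩ := exists_twistAmount_mem (hℓ x hirr) h1
    (ho.preimage (Continuous.prodMk_right x)) hxQ h2 h3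
  obtain ⟨T, hT, hTx⟩ := hT x k l M hs.1
  exact ⟨_, hs.2, hTx ▸ hT.apply_mem_orbitSet hx⟩

section

open Function

variable {n : ℕ} {A : Set (Fin n → ℝ)}

theorem vertical_mem_closure_orbitSet (hA : IsOpen A) {p : Fin n → ℝ}
    (hp : p ∈ closure (orbitSet A)) {i j : Fin n} (hij : i ≠ j) (h0 : 0 < p i) (h1 : p i < p j)
    (h2 : 2 * p i + p j < 1) {r : ℝ} (hr1 : p i < r) (hr2 : 2 * p i + r < 1) :
    update p j r ∈ closure (orbitSet A) := by
  have hpi : p i ∈ Set.Ioo (0 : ℝ) 1 := ⟨h0, by linarith⟩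
  have hℓ (x : Fin n → ℝ) (h : Irrational (x i + 0 * x j)) : Irrational (x i) := by simpa using h
  have cu (σ : ℝ) : Continuous fun y : (Fin n → ℝ) × ℝ => update y.1 j (y.1 j + σ * y.2) := by
    fun_prop
  rcases lt_trichotomy r (p j) with h | h | h
  · have := motion_mem_closure_orbitSet hA hp hij hpi 0 hℓ (cu (-1)) (δ := p j - r)
      (Q := {y | 0 < y.1 i ∧ 0 < y.2 ∧ y.2 < y.1 j - y.1 i ∧ 2 * y.1 i + y.1 j < 1}) ?_ ?_ ?_ ?_
    · simpa using this
    · refine .and ?_ (.and ?_ (.and ?_ ?_)) <;> exact isOpen_lt (by fun_prop) (by fun_prop)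
    · exact ⟨h0, by linarith, by linarith, h2⟩
    · rintro x s ⟨g1, g2, g3, g4⟩
      exact ⟨g1, g2, by linarith⟩
    · rintro x k l M ⟨-, -, g3, g4⟩
      refine ⟨_, isMcNaughtonHomeo_twist hij.symm k l M, ?_⟩
      obtain ⟨e1, e2⟩ := twist_on_side_reverse k l M g4.le g3.le
      simp only [twist, e1, e2]
      rw [update_comm hij.symm, update_eq_self]
      simp [sub_eq_add_neg]
  · simpa [h] using hp
  · have := motion_mem_closure_orbitSet hA hp hij hpi 0 hℓ (cu 1) (δ := r - p j)
      (Q := {y | 0 < y.1 i ∧ 0 < y.2 ∧ y.1 i < y.1 j ∧ y.2 < 1 - 2 * y.1 i - y.1 j}) ?_ ?_ ?_ ?_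
    · simpa using this
    · refine .and ?_ (.and ?_ (.and ?_ ?_)) <;> exact isOpen_lt (by fun_prop) (by fun_prop)
    · exact ⟨h0, by linarith, by linarith, by linarith⟩
    · rintro x s ⟨g1, g2, g3, g4⟩
      exact ⟨g1, g2, by linarith⟩
    · rintro x k l M ⟨-, -, g3, g4⟩
      refine ⟨_, isMcNaughtonHomeo_twist hij k l M, ?_⟩
      obtain ⟨e1, e2⟩ := twist_on_side k l M g3.le g4.le
      simp [twist, e1, e2]

theorem diagonal_mem_closure_orbitSet_of_pos (hA : IsOpen A) {p : Fin n → ℝ}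
    (hp : p ∈ closure (orbitSet A)) {i j : Fin n} (hij : i ≠ j) (h0 : p i + p j < 1)
    (h1 : 1 - p i - p j < p i) {t : ℝ} (ht : 0 < t) (h2 : 1 - p i - p j < p j - t) :
    update (update p i (p i + t)) j (p j - t) ∈ closure (orbitSet A) := by
  have hpi : p i ∈ Set.Ioo (0 : ℝ) 1 := ⟨by linarith, by linarith⟩
  refine motion_mem_closure_orbitSet hA hp hij hpi 1 (δ := t) (ℓ := fun x => 1 - x i - x j)
      (φ := fun y => update (update y.1 i (y.1 i + y.2)) j (y.1 j - y.2))
      (Q := {y | y.1 i + y.1 j < 1 ∧ 0 < y.2 ∧ 1 - y.1 i - y.1 j < y.1 i ∧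
        1 - y.1 i - y.1 j < y.1 j - y.2}) ?_ (by fun_prop) ?_ ?_ ?_ ?_
  · intro x hx
    have : Irrational (((1 : ℤ) : ℝ) - (x i + 1 * x j)) := hx.intCast_sub 1
    convert this using 1
    push_cast
    ring
  · refine .and ?_ (.and ?_ (.and ?_ ?_)) <;> exact isOpen_lt (by fun_prop) (by fun_prop)
  · exact ⟨h0, ht, h1, h2⟩
  · rintro x s ⟨g1, g2, g3, g4⟩
    dsimp only at *
    exact ⟨by linarith, g2, by linarith⟩
  · rintro x k l M ⟨-, -, g3, g4⟩
    refine ⟨_, isMcNaughtonHomeo_twist hij k l M, ?_⟩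
    obtain ⟨e1, e2⟩ := twist_on_hypotenuse k l M g3.le (by dsimp only at *; linarith)
    simp only [twist, e1, e2]

theorem diagonal_mem_closure_orbitSet (hA : IsOpen A) {p : Fin n → ℝ}
    (hp : p ∈ closure (orbitSet A)) {i j : Fin n} (hij : i ≠ j) (h0 : p i + p j < 1)
    (h1 : 1 - p i - p j < p i) (h2 : 1 - p i - p j < p j) {t : ℝ}
    (h3 : 1 - p i - p j < p i + t) (h4 : 1 - p i - p j < p j - t) :
    update (update p i (p i + t)) j (p j - t) ∈ closure (orbitSet A) := by
  rcases lt_trichotomy t 0 with ht | rfl | ht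
  · have := diagonal_mem_closure_orbitSet_of_pos hA hp hij.symm (t := -t) (by linarith)
      (by linarith) (by linarith) (by linarith)
    rw [update_comm hij]
    simpa [sub_eq_add_neg] using this
  · simpa using hp
  · exact diagonal_mem_closure_orbitSet_of_pos hA hp hij h0 h1 ht h4

theorem flipCoord_mem_closure_orbitSet {p : Fin n → ℝ} (hp : p ∈ closure (orbitSet A))
    (i : Fin n) : flipCoord i p ∈ closure (orbitSet A) :=
  map_mem_closure (by unfold flipCoord; fun_prop) hp
    fun _ hx => (isMcNaughtonHomeo_flipCoord i).apply_mem_orbitSet hx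

theorem swap_mem_closure_orbitSet {p : Fin n → ℝ} (hp : p ∈ closure (orbitSet A))
    (i j : Fin n) : p ∘ Equiv.swap i j ∈ closure (orbitSet A) :=
  map_mem_closure (f := fun p : Fin n → ℝ => p ∘ Equiv.swap i j) (by fun_prop) hp
    fun _ hx => (isMcNaughtonHomeo_swap i j).apply_mem_orbitSet hx

end

/-- A set of points of the plane that is stable under the symmetries of the unit square and under
translations along sides of the level triangles, within the three regions where the sides lie. -/
structure IsTriangleSaturated (E : ℝ → ℝ → Prop) : Prop where
  flip_left : ∀ {x y}, E x y → E (1 - x) y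
  swap : ∀ {x y}, E x y → E y x
  vertical : ∀ {x y r}, E x y → 0 < x → x < y → 2 * x + y < 1 → x < r → 2 * x + r < 1 → E x r
  diagonal : ∀ {x y t}, E x y → x + y < 1 → 1 - x - y < x → 1 - x - y < y → 1 - x - y < x + t →
    1 - x - y < y - t → E (x + t) (y - t)

namespace IsTriangleSaturated

variable {E : ℝ → ℝ → Prop} {x y u v t : ℝ}

theorem flip_right (hE : IsTriangleSaturated E) (h : E x y) : E x (1 - y) :=
  hE.swap (hE.flip_left (hE.swap h))

theorem antidiagonal (hE : IsTriangleSaturated E) (h : E x y) (h0 : x < y) (h1 : y - x < x)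
    (h2 : y - x < 1 - y) (h3 : y - x < x + t) (h4 : y - x < 1 - y - t) : E (x + t) (y + t) := by
  have := hE.flip_right (hE.diagonal (t := t) (hE.flip_right h) (by linarith) (by linarith)
    (by linarith) (by linarith) (by linarith))
  convert this using 1
  ring

theorem of_vertical_region (hE : IsTriangleSaturated E) (h : E x y) (hx : 0 < x) (hxy : x < y)
    (hy : 2 * x + y < 1) (hu : 0 < u) (huv : u < v) (hv : 2 * u + v < 1) : E u v := by
  obtain ⟨η, hη, hη'⟩ := exists_between (a₁ := (0 : ℝ))
    (a₂ := min (min x u) (min (1 - 3 * x) (1 - 3 * u)))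
    (lt_min (lt_min hx hu) (lt_min (by linarith) (by linarith)))
  simp only [lt_min_iff] at hη'
  obtain ⟨⟨h1, h2⟩, h3, h4⟩ := hη'
  have a := hE.vertical (r := x + η) h hx hxy hy (by linarith) (by linarith)
  have b := hE.antidiagonal (t := u - x) a (by linarith) (by linarith) (by linarith) (by linarith)
    (by linarith)
  rw [add_sub_cancel, show x + η + (u - x) = u + η by ring] at b
  exact hE.vertical b hu (by linarith) (by linarith) huv hv

theorem iff_of_vertical_region (hE : IsTriangleSaturated E) (hx : 0 < x) (hxy : x < y)
    (hy : 2 * x + y < 1) (hu : 0 < u) (huv : u < v) (hv : 2 * u + v < 1) : E x y ↔ E u v :=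
  ⟨fun h => hE.of_vertical_region h hx hxy hy hu huv hv,
    fun h => hE.of_vertical_region h hu huv hv hx hxy hy⟩

theorem iff_of_lt_half (hE : IsTriangleSaturated E) (hx : 0 < x) (hxy : x < y) (hy : y < 1 / 2) :
    E x y ↔ E (1 / 8) (1 / 4) := by
  rcases lt_or_ge (2 * x + y) 1 with h | h
  · exact hE.iff_of_vertical_region hx hxy h (by norm_num) (by norm_num) (by norm_num)
  · rw [← hE.iff_of_vertical_region (u := 1 / 8) (v := 1 / 4) (x := (1 + 2 * (y - x)) / 6)
      (y := (1 + 2 * (y - x)) / 6 + (y - x)) (by linarith) (by linarith) (by linarith)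
      (by norm_num) (by norm_num) (by norm_num)]
    constructor <;> intro g
    · convert hE.antidiagonal (t := (1 + 2 * (y - x)) / 6 - x) g hxy (by linarith) (by linarith)
        (by linarith) (by linarith) using 1 <;> ring
    · convert hE.antidiagonal (t := x - (1 + 2 * (y - x)) / 6) g (by linarith) (by linarith)
        (by linarith) (by linarith) (by linarith) using 1 <;> ring

theorem iff_of_generic (hE : IsTriangleSaturated E) (hx : x ∈ Set.Ioo (0 : ℝ) 1)
    (hy : y ∈ Set.Ioo (0 : ℝ) 1) (hx2 : x + x ≠ 1) (hy2 : y + y ≠ 1) (hxy : x ≠ y)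
    (hxy' : x + y ≠ 1) : E x y ↔ E (1 / 8) (1 / 4) := by
  have h1 {x y : ℝ} (hx : x ∈ Set.Ioo (0 : ℝ) (1 / 2)) (hy : y ∈ Set.Ioo (0 : ℝ) (1 / 2))
      (hxy : x ≠ y) : E x y ↔ E (1 / 8) (1 / 4) := by
    rcases hxy.lt_or_gt with h | h
    · exact hE.iff_of_lt_half hx.1 h hy.2
    · rw [← hE.iff_of_lt_half hy.1 h hx.2]
      exact ⟨hE.swap, hE.swap⟩
  have h2 {x y : ℝ} (hx : x ∈ Set.Ioo (0 : ℝ) (1 / 2)) (hy : y ∈ Set.Ioo (0 : ℝ) 1)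
      (hy2 : y + y ≠ 1) (hxy : x ≠ y) (hxy' : x + y ≠ 1) : E x y ↔ E (1 / 8) (1 / 4) := by
    rcases lt_or_ge y (1 / 2) with h | h
    · exact h1 hx ⟨hy.1, h⟩ hxy
    · have h' : 1 / 2 < y := h.lt_of_ne fun e => hy2 (by linarith)
      rw [← h1 (y := 1 - y) hx ⟨by linarith [hy.2], by linarith⟩ fun e => hxy' (by linarith)]
      exact ⟨hE.flip_right, fun g => by simpa using hE.flip_right g⟩
  rcases lt_or_ge x (1 / 2) with h | h
  · exact h2 ⟨hx.1, h⟩ hy hy2 hxy hxy'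
  · have h' : 1 / 2 < x := h.lt_of_ne fun e => hx2 (by linarith)
    rw [← h2 (x := 1 - x) ⟨by linarith [hx.2], by linarith⟩ hy hy2 (fun e => hxy' (by linarith))
      fun e => hxy (by linarith)]
    exact ⟨hE.flip_left, fun g => by simpa using hE.flip_left g⟩

end IsTriangleSaturated

open Function in
theorem isTriangleSaturated_closure_orbitSet {n : ℕ} {A : Set (Fin n → ℝ)} (hA : IsOpen A)
    (p : Fin n → ℝ) {i j : Fin n} (hij : i ≠ j) :
    IsTriangleSaturated fun x y => update (update p i x) j y ∈ closure (orbitSet A) where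
  flip_left {x y} h := by
    convert flipCoord_mem_closure_orbitSet h i using 1
    rw [flipCoord, update_comm hij.symm, update_idem]
    simp [hij]
  swap {x y} h := by
    convert swap_mem_closure_orbitSet h i j using 1
    ext r
    by_cases hi : r = i
    · subst hi; simp [hij]
    by_cases hj : r = j
    · subst hj; simp [hij]
    · simp [hi, hj, Equiv.swap_apply_of_ne_of_ne]
  vertical {x y r} h h0 h1 h2 h3 h4 := by
    have := vertical_mem_closure_orbitSet hA h hij (r := r)
    simp only [update_self, update_of_ne hij, update_idem] at this
    exact this h0 h1 h2 h3 h4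
  diagonal {x y t} h h0 h1 h2 h3 h4 := by
    have := diagonal_mem_closure_orbitSet hA h hij (t := t)
    simp only [update_self, update_of_ne hij] at this
    convert this h0 h1 h2 h3 h4 using 1
    rw [update_comm hij.symm, update_idem, update_comm hij, update_idem, update_comm hij.symm]

open Filter Topology in
theorem exists_generic_mem {n : ℕ} {O : Set (Fin n → ℝ)} (hO : IsOpen O) (hne : O.Nonempty)
    {C : Set ℝ} (hC : C.Finite) :
    ∃ p ∈ O, Function.Injective p ∧ (∀ i j, p i + p j ≠ 1) ∧ ∀ i, p i ∉ C := by
  obtain ⟨c, hc⟩ := hne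
  have key (a b : ℝ) (hb : b ≠ 0) : ∀ᶠ ε in 𝓝[≠] (0 : ℝ), a + ε * b ≠ 0 := by
    by_cases ha : a = 0
    · filter_upwards [self_mem_nhdsWithin] with ε hε
      simpa [ha, hb] using hε
    · have : ContinuousAt (fun ε : ℝ => a + ε * b) 0 := by fun_prop
      exact (this.eventually_ne (by simpa using ha)).filter_mono nhdsWithin_le_nhds
  let v : Fin n → ℝ := fun i => (i : ℝ) + 1
  have hv (i : Fin n) : 0 < v i := by positivity
  have e0 : ∀ᶠ ε in 𝓝[≠] (0 : ℝ), c + ε • v ∈ O := by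
    have : ContinuousAt (fun ε : ℝ => c + ε • v) 0 := by fun_prop
    exact (this.eventually_mem (hO.mem_nhds (by simpa using hc))).filter_mono nhdsWithin_le_nhds
  have e1 : ∀ᶠ ε in 𝓝[≠] (0 : ℝ), ∀ i j, i ≠ j → c i - c j + ε * (v i - v j) ≠ 0 := by
    refine eventually_all.2 fun i => eventually_all.2 fun j => eventually_imp_distrib_left.2
      fun hij => key _ _ ?_
    simpa [v, sub_eq_zero, Fin.ext_iff] using hij
  have e2 : ∀ᶠ ε in 𝓝[≠] (0 : ℝ), ∀ i j, c i + c j - 1 + ε * (v i + v j) ≠ 0 :=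
    eventually_all.2 fun i => eventually_all.2 fun j => key _ _ (add_pos (hv i) (hv j)).ne'
  have e3 : ∀ᶠ ε in 𝓝[≠] (0 : ℝ), ∀ i, ∀ z ∈ C, c i - z + ε * v i ≠ 0 :=
    eventually_all.2 fun i => (eventually_all_finite hC).2 fun z _ => key _ _ (hv i).ne'
  obtain ⟨ε, h0, h1, h2, h3⟩ := (e0.and (e1.and (e2.and e3))).exists
  refine ⟨_, h0, fun i j h => ?_, fun i j h => h2 i j ?_, fun i h => h3 i _ h ?_⟩
  · by_contra hij
    refine h1 i j hij ?_
    simp only [Pi.add_apply, Pi.smul_apply, smul_eq_mul] at h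
    linarith
  · simp only [Pi.add_apply, Pi.smul_apply, smul_eq_mul] at h
    linarith
  · simp only [Pi.add_apply, Pi.smul_apply, smul_eq_mul]
    ring

theorem exists_generic_mem_unitCube {n : ℕ} {A : Set (Fin n → ℝ)} (hA : IsOpen A)
    (hne : (A ∩ unitCube n).Nonempty) {C : Set ℝ} (hC : C.Finite) :
    ∃ p ∈ A, (∀ i, p i ∈ Set.Ioo (0 : ℝ) 1) ∧ Function.Injective p ∧
      (∀ i j, p i + p j ≠ 1) ∧ ∀ i, p i ∉ C := by
  have ho : IsOpen (Set.univ.pi fun _ : Fin n => Set.Ioo (0 : ℝ) 1) :=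
    isOpen_set_pi Set.finite_univ fun _ _ => isOpen_Ioo
  have hcl : unitCube n = closure (Set.univ.pi fun _ => Set.Ioo (0 : ℝ) 1) := by
    simp [closure_pi_set, unitCube]
  rw [hcl] at hne
  obtain ⟨x, hxA, hx⟩ := hne
  obtain ⟨p, hp, h⟩ := exists_generic_mem (hA.inter ho) (mem_closure_iff.1 hx A hA hxA) hC
  exact ⟨p, hp.1, fun i => hp.2 i trivial, h⟩

/-- For every `n ≥ 2` the group of McNaughton homeomorphisms of `[0,1]^n` acts
topologically transitively: any nonempty (relatively) open subset of the cube
can be carried to meet any other by some McNaughton homeomorphism. -/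
theorem mcnaughton_homeo_group_transitive (n : ℕ) (hn : 2 ≤ n) :
    ∀ A B : Set (Fin n → ℝ), IsOpen A → IsOpen B →
      (A ∩ unitCube n).Nonempty → (B ∩ unitCube n).Nonempty →
      ∃ S : (Fin n → ℝ) → (Fin n → ℝ), IsMcNaughtonHomeo S ∧
        (S '' (A ∩ unitCube n) ∩ B).Nonempty := by
  intro A B hA hB hAne hBne
  obtain ⟨p, hpA, hp01, hpinj, hpsum, -⟩ := exists_generic_mem_unitCube hA hAne Set.finite_empty
  obtain ⟨q, hqB, hq01, hqinj, hqsum, hqC⟩ := exists_generic_mem_unitCube hB hBne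
    ((Set.finite_range p).union (Set.finite_range fun i => 1 - p i))
  have hqp (i j : Fin n) : q i ≠ p j := fun h => hqC i (Or.inl ⟨j, h.symm⟩)
  have hqp' (i j : Fin n) : q i + p j ≠ 1 := fun h => hqC i (Or.inr ⟨j, by simp [← h]⟩)
  have hmix (s : Finset (Fin n)) : s.piecewise q p ∈ closure (orbitSet A) := by
    induction s using Finset.induction_on with
    | empty =>
      rw [Finset.piecewise_empty]
      exact subset_closure
        ⟨fun i _ => Set.Ioo_subset_Icc_self (hp01 i), _, isMcNaughtonHomeo_id, hpA⟩
    | insert i s hi ih =>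
      have : Nontrivial (Fin n) := Fin.nontrivial_iff_two_le.2 hn
      obtain ⟨j, hji⟩ := exists_ne i
      have hE := isTriangleSaturated_closure_orbitSet hA (s.piecewise q p) hji.symm
      have hpi : s.piecewise q p i = p i := Finset.piecewise_eq_of_notMem _ _ _ hi
      have hj : s.piecewise q p j = q j ∨ s.piecewise q p j = p j := by
        by_cases h : j ∈ s <;> simp [h]
      have hstart : Function.update (Function.update (s.piecewise q p) i (p i)) j
          (s.piecewise q p j) ∈ closure (orbitSet A) := by
        rw [← hpi]; simpa using ih
      rw [Finset.piecewise_insert]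
      suffices h : Function.update (Function.update (s.piecewise q p) i (q i)) j
          (s.piecewise q p j) ∈ closure (orbitSet A) by
        rwa [Function.update_comm hji.symm, Function.update_eq_self] at h
      rcases hj with hj | hj <;> rw [hj] at hstart ⊢
      · refine (hE.iff_of_generic (hq01 i) (hq01 j) (hqsum i i) (hqsum j j)
          (hqinj.ne hji.symm) (hqsum i j)).2 ?_
        exact (hE.iff_of_generic (hp01 i) (hq01 j) (hpsum i i) (hqsum j j)
          (hqp j i).symm (add_comm (q j) (p i) ▸ hqp' j i)).1 hstart
      · refine (hE.iff_of_generic (hq01 i) (hp01 j) (hqsum i i) (hpsum j j)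
          (hqp i j) (hqp' i j)).2 ?_
        exact (hE.iff_of_generic (hp01 i) (hp01 j) (hpsum i i) (hpsum j j)
          (hpinj.ne hji.symm) (hpsum i j)).1 hstart
  have hq := hmix Finset.univ
  rw [Finset.piecewise_univ] at hq
  obtain ⟨y, hyB, hy, S, ⟨hS, T, hT, h1, h2⟩, hSy⟩ := mem_closure_iff.1 hq B hB hqB
  refine ⟨T, ⟨hT, S, hS, h2, h1⟩, y, ⟨S y, ⟨hSy, hS.mapsTo hy⟩, h1 y hy⟩, hyB⟩
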